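/- arXiv:1701.04148 — 6 statements merged into one kernel-verified Lean document; each statement's English description precedes it below -/
import Mathlib

section
/- In the idealized Slim-subsketch model, after processing any finite list L of items starting from the all-zero state, for every i : Fin d and j : Fin w the counter S i j equals the maximum, over all items e occurring in L with h i e = j, of f_L(e); in particular S i j = 0 if no item occurring in L hashes to j under h i. (Paper's Theorem 1: the value of any given counter of the Slim-subsketch equals the frequency of the most frequent item that maps to it.) -/
/-- One insertion step of the idealized Slim-subsketch: an occurrence of item `e`
arrives, and `c` is the number of occurrences of `e` in the stream so far,
including this one. Letting `m` be the minimum over `i : Fin d` of `S i (h i e)`,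
every counter `S i (h i e)` with `S i (h i e) = m` and `m < c` is incremented by 1,
and all other counters are unchanged. -/
def slimStep {ι : Type} {d w : ℕ} [NeZero d] (h : Fin d → ι → Fin w)
    (S : Fin d → Fin w → ℕ) (e : ι) (c : ℕ) : Fin d → Fin w → ℕ :=
  let m := Finset.univ.inf' Finset.univ_nonempty (fun i => S i (h i e))
  fun i j => if j = h i e ∧ S i (h i e) = m ∧ m < c then S i j + 1 else S i j

/-- Process a list of items left to right, where `cnt e` records the number of
occurrences of each item `e` seen so far. -/
def slimProcessAux {ι : Type} [DecidableEq ι] {d w : ℕ} [NeZero d]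
    (h : Fin d → ι → Fin w) :
    List ι → (ι → ℕ) → (Fin d → Fin w → ℕ) → (Fin d → Fin w → ℕ)
  | [], _, S => S
  | e :: L, cnt, S =>
      slimProcessAux h L (Function.update cnt e (cnt e + 1))
        (slimStep h S e (cnt e + 1))

/-- The state of the idealized Slim-subsketch after processing the stream `L`
starting from the all-zero state. -/
def slimSketch {ι : Type} [DecidableEq ι] {d w : ℕ} [NeZero d]
    (h : Fin d → ι → Fin w) (L : List ι) : Fin d → Fin w → ℕ :=
  slimProcessAux h L (fun _ => 0) (fun _ _ => 0)

/-- Invariant: counters dominate the counts of items mapped to them, and nonzero counters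
attain one of these counts. -/
def SlimInv {ι : Type} {d w : ℕ} (h : Fin d → ι → Fin w) (cnt : ι → ℕ)
    (S : Fin d → Fin w → ℕ) : Prop :=
  (∀ i e, cnt e ≤ S i (h i e)) ∧ ∀ i j, S i j = 0 ∨ ∃ e, h i e = j ∧ cnt e = S i j

theorem slimInv_step {ι : Type} [DecidableEq ι] {d w : ℕ} [NeZero d]
    (h : Fin d → ι → Fin w) (cnt : ι → ℕ) (S : Fin d → Fin w → ℕ) (e : ι)
    (hS : SlimInv h cnt S) :
    SlimInv h (Function.update cnt e (cnt e + 1)) (slimStep h S e (cnt e + 1)) := by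
  obtain ⟨h1, h2⟩ := hS
  unfold slimStep
  have hm1 : cnt e ≤ Finset.univ.inf' Finset.univ_nonempty (fun i => S i (h i e)) :=
    Finset.le_inf' _ _ (fun i _ => h1 i e)
  have hm2 : ∀ i, Finset.univ.inf' Finset.univ_nonempty (fun i => S i (h i e)) ≤ S i (h i e) :=
    fun i => Finset.inf'_le (fun i => S i (h i e)) (Finset.mem_univ i)
  generalize Finset.univ.inf' Finset.univ_nonempty (fun i => S i (h i e)) = m at hm1 hm2
  refine ⟨fun i x => ?_, fun i j => ?_⟩
  · have a := h1 i x
    have b := hm2 i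
    by_cases hx : x = e
    · subst hx
      simp only [Function.update_self]
      split_ifs with hc
      · omega
      · simp only [true_and, not_and] at hc
        by_contra hlt
        exact hc (by omega) (by omega)
    · simp only [Function.update_of_ne hx]
      split_ifs <;> omega
  · have b := hm2 i
    have a := h1 i e
    dsimp only
    split_ifs with hc
    · obtain ⟨rfl, hc1, hc2⟩ := hc
      right
      exact ⟨e, rfl, by rw [Function.update_self]; omega⟩
    · rcases h2 i j with h0 | ⟨x, hx, hxc⟩
      · exact Or.inl h0
      · right
        by_cases hxe : x = e
        · subst hxe
          subst hx
          exact absurd ⟨rfl, by omega, by omega⟩ hc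
        · exact ⟨x, hx, by rw [Function.update_of_ne hxe]; exact hxc⟩

theorem slimInv_process {ι : Type} [DecidableEq ι] {d w : ℕ} [NeZero d]
    (h : Fin d → ι → Fin w) (L : List ι) : ∀ (cnt : ι → ℕ) (S : Fin d → Fin w → ℕ),
    SlimInv h cnt S → SlimInv h (fun x => cnt x + L.count x) (slimProcessAux h L cnt S) := by
  induction L with
  | nil => intro cnt S hS; simpa [slimProcessAux] using hS
  | cons e L ih =>
    intro cnt S hS
    have := ih _ _ (slimInv_step h cnt S e hS)
    rw [slimProcessAux]
    convert this using 2 with x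
    by_cases hx : x = e
    · subst hx
      simp
      omega
    · simp [Function.update_of_ne hx, List.count_cons_of_ne (Ne.symm hx)]

/-- Paper's Theorem 1: after processing any finite stream `L`, every counter
`S i j` of the idealized Slim-subsketch equals the frequency of the most frequent
item of `L` hashing to it (and `0` if no item of `L` hashes to it under `h i`). -/
theorem slimSketch_counter_eq_max_freq {ι : Type} [DecidableEq ι] {d w : ℕ}
    [NeZero d] [NeZero w] (h : Fin d → ι → Fin w) (L : List ι)
    (i : Fin d) (j : Fin w) :
    slimSketch h L i j
      = (L.toFinset.filter (fun e => h i e = j)).sup (fun e => L.count e) := by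
  obtain ⟨h1, h2⟩ := slimInv_process h L (fun _ => 0) (fun _ _ => 0)
    ⟨fun _ _ => le_rfl, fun _ _ => Or.inl rfl⟩
  simp only [zero_add] at h1 h2
  apply le_antisymm
  · rcases h2 i j with h0 | ⟨e, he, hc⟩
    · unfold slimSketch
      omega
    · unfold slimSketch
      rw [← hc]
      by_cases hL : e ∈ L
      · exact Finset.le_sup (f := fun e => L.count e) (by simp [hL, he])
      · simp [List.count_eq_zero_of_not_mem hL]
  · apply Finset.sup_le
    intro e he
    obtain ⟨_, rfl⟩ := Finset.mem_filter.mp he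
    exact h1 i e
end

section
/- In the idealized Slim-subsketch model, if an item e occurs in L and there exists an index i : Fin d such that every item e' occurring in L with h i e' = h i e satisfies f_L(e') ≤ f_L(e), then the query for e returns exactly f_L(e), i.e. min over i' : Fin d of S i' (h i' e) = f_L(e) for the state S obtained after processing L. -/
theorem slimProcessAux_lower {ι : Type} [DecidableEq ι] {d w : ℕ} [NeZero d]
    (h : Fin d → ι → Fin w) (L : List ι) :
    ∀ (cnt : ι → ℕ) (S : Fin d → Fin w → ℕ), (∀ x i, cnt x ≤ S i (h i x)) →
      ∀ x i, cnt x + L.count x ≤ slimProcessAux h L cnt S i (h i x) := by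
  induction L with
  | nil => intro cnt S hS x i; simpa [slimProcessAux] using hS x i
  | cons a L ih =>
    intro cnt S hS x i
    have hm : cnt a ≤ Finset.univ.inf' Finset.univ_nonempty (fun i => S i (h i a)) :=
      Finset.le_inf' _ _ (fun i _ => hS a i)
    have key := ih (Function.update cnt a (cnt a + 1)) (slimStep h S a (cnt a + 1)) (by
      intro y k
      have h2 : Finset.univ.inf' Finset.univ_nonempty (fun i => S i (h i a)) ≤ S k (h k a) :=
        Finset.inf'_le (fun i => S i (h i a)) (Finset.mem_univ k)
      have h3 := hS y k
      simp only [slimStep]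
      by_cases hy : y = a
      · subst hy
        rw [Function.update_self]
        split_ifs with hc
        · omega
        · have : ¬ (S k (h k y) = Finset.univ.inf' Finset.univ_nonempty (fun i => S i (h i y)) ∧
            Finset.univ.inf' Finset.univ_nonempty (fun i => S i (h i y)) < cnt y + 1) :=
            fun q => hc ⟨rfl, q⟩
          omega
      · rw [Function.update_of_ne hy]
        split_ifs <;> omega) x i
    simp only [slimProcessAux]
    refine le_trans ?_ key
    by_cases hx : x = a
    · subst hx
      rw [Function.update_self, List.count_cons_self]; omega
    · rw [Function.update_of_ne hx, List.count_cons_of_ne (Ne.symm hx)]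

theorem slimProcessAux_upper {ι : Type} [DecidableEq ι] {d w : ℕ} [NeZero d]
    (h : Fin d → ι → Fin w) (i : Fin d) (j : Fin w) (B : ℕ) (L : List ι) :
    ∀ (cnt : ι → ℕ) (S : Fin d → Fin w → ℕ), S i j ≤ B →
      (∀ x ∈ L, h i x = j → cnt x + L.count x ≤ B) →
      slimProcessAux h L cnt S i j ≤ B := by
  induction L with
  | nil => intro cnt S hS _; simpa [slimProcessAux] using hS
  | cons a L ih =>
    intro cnt S hS hB
    simp only [slimProcessAux]
    apply ih
    · simp only [slimStep]
      split_ifs with hc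
      · obtain ⟨h1, h2, h3⟩ := hc
        have h4 := hB a List.mem_cons_self h1.symm
        rw [List.count_cons_self] at h4
        rw [← h2, ← h1] at h3
        omega
      · exact hS
    · intro x hx hj
      have h4 := hB x (List.mem_cons_of_mem _ hx) hj
      by_cases hxa : x = a
      · subst hxa
        rw [List.count_cons_self] at h4
        rw [Function.update_self]; omega
      · rw [List.count_cons_of_ne (Ne.symm hxa)] at h4
        rwa [Function.update_of_ne hxa]

/-- If an item `e` occurs in `L` and for some array index `i` every item of `L`
colliding with `e` under `h i` has frequency at most that of `e`, then the
query for `e` (the minimum of the `d` hashed counters of the Slim-subsketch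
after processing `L`) returns exactly the frequency of `e` in `L`. -/
theorem slimSketch_query_eq_count {ι : Type} [DecidableEq ι] {d w : ℕ}
    [NeZero d] [NeZero w] (h : Fin d → ι → Fin w) (L : List ι) (e : ι)
    (he : e ∈ L)
    (hdom : ∃ i : Fin d, ∀ e' ∈ L, h i e' = h i e → L.count e' ≤ L.count e) :
    Finset.univ.inf' Finset.univ_nonempty
        (fun i' : Fin d => slimSketch h L i' (h i' e)) = L.count e := by
  obtain ⟨i, hi⟩ := hdom
  apply le_antisymm
  · refine le_trans (Finset.inf'_le _ (Finset.mem_univ i)) ?_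
    exact slimProcessAux_upper h i (h i e) (L.count e) L _ _ (Nat.zero_le _)
      (fun x hx hj => by simpa using hi x hx hj)
  · refine Finset.le_inf' _ _ (fun k _ => ?_)
    simpa [slimSketch] using
      slimProcessAux_lower h L (fun _ => 0) (fun _ _ => 0) (fun _ _ => le_rfl) e k
end

section
/- In the idealized Slim-subsketch model, after processing any finite list L of items starting from the all-zero state, every counter is bounded by the total number of stream occurrences hashing to it: for all i : Fin d and j : Fin w, S i j ≤ the number of entries e' of L (counted with multiplicity) satisfying h i e' = j. -/
theorem slimStep_le {ι : Type} {d w : ℕ} [NeZero d] (h : Fin d → ι → Fin w)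
    (S : Fin d → Fin w → ℕ) (e : ι) (c : ℕ) (i : Fin d) (j : Fin w) :
    slimStep h S e c i j ≤ S i j + if h i e = j then 1 else 0 := by
  unfold slimStep
  split_ifs with h1 h2 h2
  · exact le_rfl
  · exact absurd h1.1.symm h2
  · omega
  · omega

theorem slimProcessAux_le {ι : Type} [DecidableEq ι] {d w : ℕ} [NeZero d]
    (h : Fin d → ι → Fin w) (i : Fin d) (j : Fin w) (L : List ι) :
    ∀ (cnt : ι → ℕ) (S : Fin d → Fin w → ℕ),
      slimProcessAux h L cnt S i j ≤
        S i j + (L.filter (fun e' => h i e' = j)).length := by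
  induction L with
  | nil => intro cnt S; simp [slimProcessAux]
  | cons e L ih =>
    intro cnt S
    have h1 := ih (Function.update cnt e (cnt e + 1)) (slimStep h S e (cnt e + 1))
    have h2 := slimStep_le h S e (cnt e + 1) i j
    rw [slimProcessAux]
    by_cases he : h i e = j
    · simp only [he, if_true, List.filter_cons, decide_true, List.length_cons] at *
      omega
    · simp only [he, if_false, List.filter_cons, decide_false, Bool.false_eq_true] at *
      omega

/-- After processing any finite stream `L`, every counter of the idealized
Slim-subsketch is bounded by the total number of stream occurrences (counted
with multiplicity) hashing to it. -/
theorem slimSketch_counter_le_collisions {ι : Type} [DecidableEq ι] {d w : ℕ}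
    [NeZero d] [NeZero w] (h : Fin d → ι → Fin w) (L : List ι)
    (i : Fin d) (j : Fin w) :
    slimSketch h L i j ≤ (L.filter (fun e' => h i e' = j)).length := by
  simpa [slimSketch] using slimProcessAux_le h i j L (fun _ => 0) (fun _ _ => 0)
end

section
/- Let v, w, d be positive integers and let H be a uniformly random element of Fin d → Fin v → Fin w, i.e. H is distributed according to the uniform probability distribution on the finite set of all such functions (equivalently, d independent uniformly random hash functions). Then for any fixed index l with 1 ≤ l ≤ v, the probability that there exists i : Fin d such that H i m ≠ H i l for every index m with l < m ≤ v equals 1 − (1 − (1 − 1/w)^{v−l})^d. (The paper's probability P_CR{e_l} that the query result for the l-th most infrequent of v items is correct, with d hash arrays.) -/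
lemma card_good_aux (v w : ℕ) [NeZero w] (l : Fin v) :
    (((Finset.univ.filter
      (fun f : Fin v → Fin w => ∀ m : Fin v, l < m → f m ≠ f l)).card : ℕ) : ℝ)
      = (w : ℝ) ^ v * (1 - 1 / (w : ℝ)) ^ (v - (l.val + 1)) := by
  classical
  have hw : (w : ℝ) ≠ 0 := Nat.cast_ne_zero.mpr (NeZero.ne w)
  have hw1 : 1 ≤ w := Nat.one_le_iff_ne_zero.mpr (NeZero.ne w)
  let t : Fin w → Fin v → Finset (Fin w) := fun c m =>
    if m = l then {c} else if l < m then {c}ᶜ else Finset.univ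
  have hfib : ∀ c : Fin w,
      (Finset.univ.filter
        (fun f : Fin v → Fin w => ∀ m : Fin v, l < m → f m ≠ f l)).filter (fun f => f l = c)
      = Fintype.piFinset (t c) := by
    intro c
    ext f
    simp only [Finset.mem_filter, Finset.mem_univ, true_and, Fintype.mem_piFinset]
    constructor
    · rintro ⟨h, rfl⟩ m
      by_cases h1 : m = l
      · simp [t, h1]
      · by_cases h2 : l < m
        · simp [t, h1, h2, h m h2]
        · simp [t, h1, h2]
    · intro h
      have hl : f l = c := by simpa [t] using h l
      refine ⟨fun m hm => ?_, hl⟩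
      have := h m
      rw [hl]
      simpa [t, hm, hm.ne'] using this
  have hcard : ∀ c : Fin w, (((Fintype.piFinset (t c)).card : ℕ) : ℝ)
      = (w : ℝ) ^ v * (1 / (w : ℝ)) * (1 - 1 / (w : ℝ)) ^ (v - (l.val + 1)) := by
    intro c
    rw [Fintype.card_piFinset, Nat.cast_prod]
    have : ∀ m : Fin v, (((t c m).card : ℕ) : ℝ)
        = (w : ℝ) * (if m = l then 1 / (w : ℝ) else 1) *
          (if l < m then (1 - 1 / (w : ℝ)) else 1) := by
      intro m
      by_cases h1 : m = l
      · simp [t, h1, hw]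
      · by_cases h2 : l < m
        · simp only [t, h1, h2, if_true, if_false, Finset.card_compl, Finset.card_singleton,
            Fintype.card_fin]
          rw [Nat.cast_sub hw1]
          field_simp
          simp
        · simp [t, h1, h2]
    simp only [this, Finset.prod_mul_distrib]
    have h3 : (∏ m : Fin v, (if l < m then (1 - 1 / (w : ℝ)) else 1))
        = (1 - 1 / (w : ℝ)) ^ (v - (l.val + 1)) := by
      rw [← Finset.prod_filter, Finset.prod_const]
      congr 1
      have : Finset.univ.filter (fun m : Fin v => l < m) = Finset.Ioi l := by ext; simp
      rw [this, Fin.card_Ioi]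
      omega
    rw [h3]
    simp
  rw [Finset.card_eq_sum_card_fiberwise (f := fun f => f l) (t := Finset.univ) (by simp)]
  push_cast
  simp only [hfib, hcard]
  simp
  field_simp

/-- For `d` independent uniformly random hash functions, i.e. a uniformly random
`H : Fin d → Fin v → Fin w`, the probability that for some array `i : Fin d`
no index `m` above a fixed index `l` collides with `l` under `H i` equals
`1 − (1 − (1 − 1/w)^(v − l))^d` (indices of `Fin v` are identified with
`{1, …, v}`, so the index `l : Fin v` stands for `l.val + 1` and there are
`v − (l.val + 1)` larger indices). -/
theorem prob_exists_array_no_collision (v w d : ℕ) [NeZero v] [NeZero w]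
    [NeZero d] (l : Fin v) :
    (PMF.uniformOfFintype (Fin d → Fin v → Fin w)).toMeasure
        {H : Fin d → Fin v → Fin w |
          ∃ i : Fin d, ∀ m : Fin v, l < m → H i m ≠ H i l}
      = ENNReal.ofReal
          (1 - (1 - (1 - 1 / (w : ℝ)) ^ (v - (l.val + 1))) ^ d) := by
  classical
  have hw : (w : ℝ) ≠ 0 := Nat.cast_ne_zero.mpr (NeZero.ne w)
  rw [PMF.toMeasure_uniformOfFintype_apply _ (MeasurableSet.of_discrete)]
  have hA := card_good_aux v w l
  set A := Finset.univ.filter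
      (fun f : Fin v → Fin w => ∀ m : Fin v, l < m → f m ≠ f l) with hAdef
  have hS : (Fintype.card {H : Fin d → Fin v → Fin w |
          ∃ i : Fin d, ∀ m : Fin v, l < m → H i m ≠ H i l})
      = (Fintype.piFinset (fun _ : Fin d => Aᶜ))ᶜ.card := by
    rw [← Set.toFinset_card]
    congr 1
    ext H
    simp [hAdef, Fintype.mem_piFinset]
  have hR : (((Fintype.piFinset (fun _ : Fin d => Aᶜ))ᶜ.card : ℕ) : ℝ)
      = ((w : ℝ) ^ v) ^ d *
        (1 - (1 - (1 - 1 / (w : ℝ)) ^ (v - (l.val + 1))) ^ d) := by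
    rw [Finset.card_compl, Nat.cast_sub (Finset.card_le_univ _), Fintype.card_piFinset]
    rw [Finset.prod_const, Finset.card_compl, Nat.cast_pow,
      Nat.cast_sub (Finset.card_le_univ _), hA]
    simp only [Fintype.card_pi, Finset.prod_const, Finset.card_univ, Fintype.card_fin]
    push_cast
    rw [mul_sub, ← mul_pow]
    ring
  have hpos : (0 : ℝ) < ((w : ℝ) ^ v) ^ d := by
    have : (0 : ℝ) < w := lt_of_le_of_ne (Nat.cast_nonneg _) hw.symm
    positivity
  have hfin : (1 - (1 - (1 - 1 / (w : ℝ)) ^ (v - (l.val + 1))) ^ d)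
      = (((Fintype.piFinset (fun _ : Fin d => Aᶜ))ᶜ.card : ℕ) : ℝ) / ((w ^ v) ^ d : ℕ) := by
    rw [hR]
    push_cast
    field_simp
  rw [hfin, ENNReal.ofReal_div_of_pos (by exact_mod_cast hpos), ENNReal.ofReal_natCast,
    ENNReal.ofReal_natCast]
  congr 1
  · exact_mod_cast hS
  · simp
end

section
/- Let ι be a finite type of items, f : ι → ℕ a frequency function with total N = Σ_{e'} f(e'), w a positive integer, and e : ι a fixed item. Let H be a uniformly random function ι → Fin w. Then the expected over-count at the counter of e, namely E[ Σ over e' ≠ e with H e' = H e of f(e') ], equals (N − f(e)) / w; in particular it is at most N / w. (The paper's Equation (2): E(X_{i,(e)}[j]) ≤ N/w for a uniformly distributed hash function.) -/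
theorem collide_card {ι : Type} [Fintype ι] [DecidableEq ι] (w : ℕ) {e e' : ι} (h : e' ≠ e) :
    (Finset.univ.filter (fun H : ι → Fin w => H e' = H e)).card * w
      = Fintype.card (ι → Fin w) := by
  have E : {H : ι → Fin w // H e' = H e} × Fin w ≃ (ι → Fin w) :=
    { toFun := fun p => Function.update p.1.1 e' p.2
      invFun := fun H => (⟨Function.update H e' (H e), by simp [Function.update_of_ne h.symm]⟩, H e')
      left_inv := by
        rintro ⟨⟨H, hH⟩, c⟩
        simp [Function.update_of_ne h.symm, ← hH]
      right_inv := by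
        intro H
        simp }
  have := Fintype.card_congr E
  rw [Fintype.card_prod, Fintype.card_fin, Fintype.card_subtype] at this
  exact this

/-- Paper's Equation (2): for a uniformly random hash function `H : ι → Fin w`,
the expected over-count at the counter of a fixed item `e`, i.e. the expectation
of `Σ_{e' ≠ e, H e' = H e} f e'`, equals `(N − f e)/w` where `N = Σ_{e'} f e'`;
in particular it is at most `N / w`. -/
theorem expected_overcount_eq {ι : Type} [Fintype ι] [DecidableEq ι]
    [Nonempty ι] (f : ι → ℕ) (w : ℕ) [NeZero w] (e : ι) :
    (∫ H : ι → Fin w,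
        ∑ e' ∈ Finset.univ.filter (fun e' : ι => e' ≠ e ∧ H e' = H e),
          (f e' : ℝ)
        ∂(PMF.uniformOfFintype (ι → Fin w)).toMeasure)
        = ((∑ e' : ι, (f e' : ℝ)) - (f e : ℝ)) / (w : ℝ)
    ∧ (∫ H : ι → Fin w,
        ∑ e' ∈ Finset.univ.filter (fun e' : ι => e' ≠ e ∧ H e' = H e),
          (f e' : ℝ)
        ∂(PMF.uniformOfFintype (ι → Fin w)).toMeasure)
        ≤ (∑ e' : ι, (f e' : ℝ)) / (w : ℝ) := by
  have hw : (w : ℝ) ≠ 0 := Nat.cast_ne_zero.mpr (NeZero.ne w)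
  have hC : (Fintype.card (ι → Fin w) : ℝ) ≠ 0 := Nat.cast_ne_zero.mpr Fintype.card_ne_zero
  have key : (∫ H : ι → Fin w,
        ∑ e' ∈ Finset.univ.filter (fun e' : ι => e' ≠ e ∧ H e' = H e),
          (f e' : ℝ)
        ∂(PMF.uniformOfFintype (ι → Fin w)).toMeasure)
        = ((∑ e' : ι, (f e' : ℝ)) - (f e : ℝ)) / (w : ℝ) := by
    rw [PMF.integral_eq_sum]
    simp only [PMF.uniformOfFintype_apply, ENNReal.toReal_inv, ENNReal.toReal_natCast,
      smul_eq_mul]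
    rw [← Finset.mul_sum]
    simp only [Finset.sum_filter]
    rw [Finset.sum_comm]
    have h1 : ∀ e' : ι, (∑ H : ι → Fin w, if e' ≠ e ∧ H e' = H e then (f e' : ℝ) else 0)
        = (Fintype.card (ι → Fin w) : ℝ) / w * (if e' = e then 0 else (f e' : ℝ)) := by
      intro e'
      by_cases h : e' = e
      · simp [h]
      · have hc := collide_card w h
        have hc' : ((Finset.univ.filter (fun H : ι → Fin w => H e' = H e)).card : ℝ) * w
            = (Fintype.card (ι → Fin w) : ℝ) := by exact_mod_cast hc
        simp only [ne_eq, h, not_false_eq_true, true_and, if_false]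
        rw [← Finset.sum_filter, Finset.sum_const, nsmul_eq_mul, ← hc', mul_div_cancel_right₀ _ hw]
    rw [Finset.sum_congr rfl (fun e' _ => h1 e'), ← Finset.mul_sum]
    have h2 : (∑ e' : ι, if e' = e then 0 else (f e' : ℝ)) = (∑ e' : ι, (f e' : ℝ)) - f e := by
      rw [eq_sub_iff_add_eq, ← Finset.sum_erase_add _ _ (Finset.mem_univ e),
        ← Finset.sum_erase_add _ (fun e' => (f e' : ℝ)) (Finset.mem_univ e)]
      simp only [if_true, add_zero]
      congr 1
      exact Finset.sum_congr rfl (fun x hx => if_neg (Finset.ne_of_mem_erase hx))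
    rw [h2]
    field_simp
  refine ⟨key, ?_⟩
  rw [key]
  gcongr
  simp
end

section
/- Consider the idealized Slim-subsketch model with item type ι = Fin v, where the hash functions h are chosen uniformly at random from the finite set of all functions Fin d → Fin v → Fin w. Let L be a finite list over Fin v in which every item occurs at least once and whose occurrence counts are nondecreasing in the item index: f_L(e_1) ≤ f_L(e_2) ≤ … ≤ f_L(e_v). Then the expected number of indices l ∈ {1, …, v} for which the query for e_l after processing L returns exactly f_L(e_l) is at least Σ_{l=1}^{v} (1 − (1 − (1 − 1/w)^{v−l})^d). Equivalently, the expected correct rate Cr (the expected fraction of the v items whose query contains no error) satisfies Cr ≥ (1/v) Σ_{l=1}^{v} (1 − (1 − (1 − 1/w)^{v−l})^d). (The paper's Equation (1).) -/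
theorem slim_lower {ι : Type} [DecidableEq ι] {d w : ℕ} [NeZero d]
    (h : Fin d → ι → Fin w) (L : List ι) :
    ∀ (cnt : ι → ℕ) (S : Fin d → Fin w → ℕ), (∀ e i, cnt e ≤ S i (h i e)) →
      ∀ e i, cnt e + L.count e ≤ slimProcessAux h L cnt S i (h i e) := by
  induction L with
  | nil => intro cnt S hS e i; simpa [slimProcessAux] using hS e i
  | cons a L ih =>
    intro cnt S hS e i
    have key : ∀ e i, Function.update cnt a (cnt a + 1) e
        ≤ slimStep h S a (cnt a + 1) i (h i e) := by
      intro e i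
      have hm : Finset.univ.inf' Finset.univ_nonempty (fun i => S i (h i a)) ≤ S i (h i a) :=
        Finset.inf'_le (fun i => S i (h i a)) (Finset.mem_univ i)
      have hm2 : cnt a ≤ Finset.univ.inf' Finset.univ_nonempty (fun i => S i (h i a)) :=
        Finset.le_inf' _ _ (fun i _ => hS a i)
      have h1 := hS e i
      unfold slimStep
      by_cases hea : e = a
      · subst hea
        simp only [Function.update_self]
        split_ifs with hc
        · omega
        · simp only [true_and, not_and, not_lt] at hc
          by_contra hlt
          have := hc (by omega)
          omega
      · rw [Function.update_of_ne hea]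
        split_ifs <;> omega
    have := ih _ _ key e i
    rw [slimProcessAux]
    refine le_trans ?_ this
    by_cases hea : e = a
    · subst hea; simp; omega
    · rw [Function.update_of_ne hea, List.count_cons_of_ne (Ne.symm hea)]

theorem slim_upper {ι : Type} [DecidableEq ι] {d w : ℕ} [NeZero d]
    (h : Fin d → ι → Fin w) (i : Fin d) (j : Fin w) (b : ℕ) (L : List ι) :
    ∀ (cnt : ι → ℕ) (S : Fin d → Fin w → ℕ), S i j ≤ b →
      (∀ e, h i e = j → cnt e + L.count e ≤ b) → slimProcessAux h L cnt S i j ≤ b := by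
  induction L with
  | nil => intro cnt S hS _; simpa [slimProcessAux] using hS
  | cons a L ih =>
    intro cnt S hS hb
    rw [slimProcessAux]
    apply ih
    · unfold slimStep
      split_ifs with hc
      · obtain ⟨h1, h2, h3⟩ := hc
        have := hb a h1.symm
        rw [List.count_cons_self] at this
        rw [← h1] at h2
        omega
      · exact hS
    · intro e he
      have := hb e he
      by_cases hea : e = a
      · subst hea; simp at this ⊢; omega
      · rwa [Function.update_of_ne hea, ← List.count_cons_of_ne (Ne.symm hea)]

theorem slim_correct {d w v : ℕ} [NeZero d] (L : List (Fin v))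
    (hmono : Monotone fun e : Fin v => L.count e) (h : Fin d → Fin v → Fin w) (l : Fin v)
    (hg : ∃ i, ∀ k, l < k → h i k ≠ h i l) :
    Finset.univ.inf' Finset.univ_nonempty
      (fun i : Fin d => slimSketch h L i (h i l)) = L.count l := by
  obtain ⟨i, hi⟩ := hg
  apply le_antisymm
  · refine (Finset.inf'_le _ (Finset.mem_univ i)).trans ?_
    apply slim_upper
    · simp
    · intro e he
      have : e ≤ l := by
        by_contra hlt
        exact hi e (not_le.mp hlt) he
      simpa using hmono this
  · refine Finset.le_inf' _ _ (fun i _ => ?_)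
    simpa [slimSketch] using slim_lower h L (fun _ => 0) (fun _ _ => 0) (by simp) l i

theorem card_good {w v : ℕ} (l : Fin v) :
    (Finset.univ.filter (fun g : Fin v → Fin w => ∀ k, l < k → g k ≠ g l)).card
      = w * ((w - 1) ^ (v - (l.val + 1)) * w ^ l.val) := by
  classical
  rw [Finset.card_eq_sum_card_fiberwise (f := fun g => g l) (t := Finset.univ)
    (fun _ _ => by simp)]
  have : ∀ a : Fin w, ((Finset.univ.filter
      (fun g : Fin v → Fin w => ∀ k, l < k → g k ≠ g l)).filter (fun g => g l = a)).card
      = (w - 1) ^ (v - (l.val + 1)) * w ^ l.val := by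
    intro a
    have h1 : ((Finset.univ.filter
      (fun g : Fin v → Fin w => ∀ k, l < k → g k ≠ g l)).filter (fun g => g l = a))
      = Fintype.piFinset (fun k => if k = l then {a} else if l < k then Finset.univ.erase a
          else Finset.univ) := by
      ext g
      simp only [Finset.mem_filter, Finset.mem_univ, true_and, Fintype.mem_piFinset]
      constructor
      · rintro ⟨h1, h2⟩ k
        split_ifs with h3 h4
        · subst h3; simpa using h2
        · simpa [← h2] using h1 k h4
        · simp
      · intro h1
        have h2 : g l = a := by simpa using h1 l
        refine ⟨fun k hk => ?_, h2⟩
        have := h1 k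
        rw [if_neg hk.ne', if_pos hk] at this
        rw [h2]
        simpa using this
    rw [h1, Fintype.card_piFinset]
    have h2 : ∀ k : Fin v, (if k = l then ({a} : Finset (Fin w)) else
        if l < k then Finset.univ.erase a else Finset.univ).card
        = (if l < k then (w - 1) else 1) * (if k < l then w else 1) := by
      intro k
      rcases lt_trichotomy k l with hk | hk | hk
      · simp [hk, hk.ne, not_lt.mpr hk.le]
      · simp [hk]
      · simp [hk, hk.ne', not_lt.mpr hk.le]
    simp_rw [h2]
    rw [Finset.prod_mul_distrib, Finset.prod_ite, Finset.prod_ite]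
    simp only [Finset.prod_const, one_pow, mul_one]
    congr 2
    · rw [Finset.filter_lt_eq_Ioi, Fin.card_Ioi]; omega
    · rw [Finset.filter_gt_eq_Iio, Fin.card_Iio]
  rw [Finset.sum_congr rfl (fun a _ => this a)]
  simp

theorem prob_good (d w v : ℕ) [NeZero w] (l : Fin v) :
    (1 - (1 - (1 - 1 / (w : ℝ)) ^ (v - (l.val + 1))) ^ d)
     = ((w ^ v) ^ d : ℝ)⁻¹ * ((Finset.univ.filter (fun h : Fin d → Fin v → Fin w =>
        ∃ i, ∀ k, l < k → h i k ≠ h i l)).card : ℝ) := by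
  classical
  have hw : (w : ℝ) ≠ 0 := by exact_mod_cast NeZero.ne w
  have hw1 : 1 ≤ w := Nat.one_le_iff_ne_zero.mpr (NeZero.ne w)
  set B := Finset.univ.filter (fun g : Fin v → Fin w => ¬ ∀ k, l < k → g k ≠ g l) with hB
  have h1 := Finset.card_filter_add_card_filter_not (s := (Finset.univ : Finset (Fin v → Fin w)))
    (fun g => ∀ k, l < k → g k ≠ g l)
  rw [card_good, ← hB] at h1
  have h2 := Finset.card_filter_add_card_filter_not
    (s := (Finset.univ : Finset (Fin d → Fin v → Fin w)))
    (fun h => ∃ i, ∀ k, l < k → h i k ≠ h i l)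
  have h3 : (Finset.univ.filter (fun h : Fin d → Fin v → Fin w =>
      ¬ ∃ i, ∀ k, l < k → h i k ≠ h i l)) = Fintype.piFinset (fun _ => B) := by
    ext h
    simp [hB, Fintype.mem_piFinset]
  rw [h3, Fintype.card_piFinset] at h2
  simp only [Finset.prod_const, Finset.card_univ, Fintype.card_fin, Fintype.card_pi] at h1 h2
  have h1' : (w : ℝ) * (((w : ℝ) - 1) ^ (v - (l.val + 1)) * (w : ℝ) ^ l.val) + B.card
      = (w : ℝ) ^ v := by
    have h5 : ((w * ((w - 1) ^ (v - (l.val + 1)) * w ^ l.val) + B.card : ℕ) : ℝ)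
        = ((w ^ v : ℕ) : ℝ) := by rw [h1]
    push_cast [Nat.cast_sub hw1] at h5
    exact h5
  have h2' : ((Finset.univ.filter (fun h : Fin d → Fin v → Fin w =>
        ∃ i, ∀ k, l < k → h i k ≠ h i l)).card : ℝ) + (B.card : ℝ) ^ d = ((w : ℝ) ^ v) ^ d := by
    exact_mod_cast h2
  have h4 : (1 - (1 - 1 / (w : ℝ)) ^ (v - (l.val + 1))) = B.card / (w : ℝ) ^ v := by
    have e1 : (w : ℝ) ^ v = w ^ (v - (l.val + 1)) * (w * w ^ l.val) := by
      rw [← pow_succ', ← pow_add]; congr 1; omega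
    have e2 : 1 - 1 / (w : ℝ) = (w - 1) / w := by field_simp
    rw [eq_sub_of_add_eq' h1', sub_div, div_self (by positivity), e2, div_pow, e1]
    field_simp
  rw [h4, eq_sub_of_add_eq h2', div_pow, mul_sub, inv_mul_cancel₀ (by positivity)]
  rw [div_eq_inv_mul]

/-- Paper's Equation (1): for the idealized Slim-subsketch over items `Fin v`
with a uniformly random family of hash functions `h : Fin d → Fin v → Fin w`,
if every item occurs in `L` and the occurrence counts are nondecreasing in the
item index, then the expected number of items `l` whose query returns exactly
`L.count l` is at least `Σ_{l=1}^{v} (1 − (1 − (1 − 1/w)^{v−l})^d)`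
(equivalently, the expected correct rate is at least `1/v` times this sum). -/
theorem slimSketch_expected_correct_count (d w v : ℕ) [NeZero d] [NeZero w]
    [NeZero v] (L : List (Fin v)) (hall : ∀ e : Fin v, e ∈ L)
    (hmono : Monotone fun e : Fin v => L.count e) :
    ∑ l : Fin v, (1 - (1 - (1 - 1 / (w : ℝ)) ^ (v - (l.val + 1))) ^ d)
      ≤ ∫ h : Fin d → Fin v → Fin w,
          ((Finset.univ.filter (fun l : Fin v =>
              Finset.univ.inf' Finset.univ_nonempty
                (fun i : Fin d => slimSketch h L i (h i l)) = L.count l)).card : ℝ)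
          ∂(PMF.uniformOfFintype (Fin d → Fin v → Fin w)).toMeasure := by
  classical
  rw [PMF.integral_eq_sum]
  simp only [PMF.uniformOfFintype_apply, smul_eq_mul, ← Finset.mul_sum]
  simp only [Finset.card_filter, Nat.cast_sum]
  rw [Finset.sum_comm, Finset.mul_sum]
  refine Finset.sum_le_sum (fun l _ => ?_)
  rw [prob_good]
  have hN : ((Fintype.card (Fin d → Fin v → Fin w) : ENNReal)⁻¹).toReal
      = ((w ^ v) ^ d : ℝ)⁻¹ := by
    simp
  rw [hN, Finset.card_filter, Nat.cast_sum]
  refine mul_le_mul_of_nonneg_left (Finset.sum_le_sum fun h _ => ?_) (by positivity)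
  by_cases hg : ∃ i, ∀ k, l < k → h i k ≠ h i l
  · rw [if_pos hg, if_pos (slim_correct L hmono h l hg)]
  · rw [if_neg hg, Nat.cast_zero]; exact Nat.cast_nonneg _
end
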